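/- arXiv:1811.02207 — 2 statements merged into one kernel-verified Lean document; each statement's English description precedes it below -/
import Mathlib

section
/- Let d ∈ ℕ, 𝐤 ∈ ℕ^d, m ∈ ℕ, and let 𝒱^𝐤_m = {𝐚 ∈ ℕ^d : 𝐚 ≼ 𝐤, |𝐚| = m}. For any subset T ⊆ 𝒱^𝐤_m, letting T⁺ := (↑T) ∩ 𝒱^𝐤_{m+1} where ↑T = {𝐜 ∈ ℕ^d : ∃ 𝐭 ∈ T, 𝐭 ≼ 𝐜}, we have |𝒱^𝐤_{m+1}| · |T| ≤ |𝒱^𝐤_m| · |T⁺|. -/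
open Finset
open scoped Classical

/-- The vectors `a ≤ k` with coordinate sum `m`; the level `m` is an integer, so that levels can be
shifted freely. -/
noncomputable def boxLevel {d : ℕ} (k : Fin d → ℕ) (m : ℤ) : Finset (Fin d → ℕ) :=
  (Finset.Iic k).filter (fun a => ∑ i, (a i : ℤ) = m)

theorem mem_boxLevel {d : ℕ} {k a : Fin d → ℕ} {m : ℤ} :
    a ∈ boxLevel k m ↔ a ≤ k ∧ ∑ i, (a i : ℤ) = m := by
  simp [boxLevel]

theorem cons_mem_boxLevel {d : ℕ} {k : Fin (d + 1) → ℕ} {j : ℕ} {b : Fin d → ℕ} {m : ℤ} :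
    (Fin.cons j b : Fin (d + 1) → ℕ) ∈ boxLevel k m ↔
      j ≤ k 0 ∧ b ∈ boxLevel (Fin.tail k) (m - j) := by
  simp only [mem_boxLevel, Fin.cons_le, Fin.sum_univ_succ, Fin.cons_zero, Fin.cons_succ,
    eq_sub_iff_add_eq', and_assoc]

theorem sum_boxLevel_succ {d : ℕ} (k : Fin (d + 1) → ℕ) (m : ℤ) (f : (Fin (d + 1) → ℕ) → ℝ) :
    ∑ a ∈ boxLevel k m, f a =
      ∑ j ∈ range (k 0 + 1), ∑ b ∈ boxLevel (Fin.tail k) (m - j), f (Fin.cons j b) := by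
  rw [Finset.sum_sigma']
  refine Finset.sum_bij' (fun a _ => ⟨a 0, Fin.tail a⟩) (fun p _ => Fin.cons p.1 p.2)
    ?_ ?_ ?_ ?_ ?_
  · intro a ha
    rw [← Fin.cons_self_tail a, cons_mem_boxLevel] at ha
    simpa [Nat.lt_succ_iff] using ha
  · rintro ⟨j, b⟩ h
    simpa [cons_mem_boxLevel, Nat.lt_succ_iff] using h
  · intro a _
    exact Fin.cons_self_tail a
  · rintro ⟨j, b⟩ _
    simp
  · intro a _
    simp only [Fin.cons_self_tail]

theorem card_boxLevel_succ {d : ℕ} (k : Fin (d + 1) → ℕ) (m : ℤ) :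
    (#(boxLevel k m) : ℝ) = ∑ j ∈ range (k 0 + 1), (#(boxLevel (Fin.tail k) (m - j)) : ℝ) := by
  simpa using sum_boxLevel_succ k m (fun _ => 1)

/-- Log-concavity without internal zeros, in the two-point form. -/
def IsLogConcaveSeq (N : ℤ → ℝ) : Prop :=
  ∀ x y u v : ℤ, x + y = u + v → v ≤ x → v ≤ y → N u * N v ≤ N x * N y

theorem IsLogConcaveSeq.of_adjacent {N : ℤ → ℝ}
    (h : ∀ p q : ℤ, p ≤ q → N (q + 1) * N p ≤ N q * N (p + 1)) : IsLogConcaveSeq N := by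
  have key : ∀ (t : ℕ) (u v : ℤ), v + 2 * t ≤ u → N u * N v ≤ N (u - t) * N (v + t) := by
    intro t
    induction t with
    | zero => intro u v _; simp
    | succ t ih =>
      intro u v huv
      push_cast at huv ⊢
      have h₁ := ih u v (by omega)
      have h₂ := h (v + t) (u - t - 1) (by omega)
      rw [sub_add_cancel] at h₂
      rw [← sub_sub, ← add_assoc]
      exact h₁.trans h₂
  intro x y u v hxy hx hy
  rcases le_total x y with hle | hle
  · have := key (x - v).toNat u v (by omega)
    rw [show u - ((x - v).toNat : ℤ) = y by omega, show v + ((x - v).toNat : ℤ) = x by omega] at this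
    linarith
  · have := key (y - v).toNat u v (by omega)
    rwa [show u - ((y - v).toNat : ℤ) = x by omega, show v + ((y - v).toNat : ℤ) = y by omega] at this

theorem sum_window_add_one (N : ℤ → ℝ) (m : ℤ) (j : ℕ) :
    ∑ i ∈ range (j + 1), N (m + 1 - i) = N (m + 1) + ∑ i ∈ range j, N (m - i) := by
  rw [Finset.sum_range_succ', add_comm]
  simp

theorem IsLogConcaveSeq.sum_window {N : ℤ → ℝ} (h : IsLogConcaveSeq N) (c : ℕ) :
    IsLogConcaveSeq (fun m => ∑ j ∈ range (c + 1), N (m - j)) := by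
  refine .of_adjacent fun p q hpq => ?_
  have shift (m : ℤ) : ∑ j ∈ range (c + 1), N (m + 1 - j) =
      N (m + 1) + ∑ j ∈ range (c + 1), N (m - j) - N (m - c) := by
    rw [sum_window_add_one, Finset.sum_range_succ]
    ring
  have h₁ : N (q + 1) * ∑ j ∈ range (c + 1), N (p - j) ≤
      N (p + 1) * ∑ j ∈ range (c + 1), N (q - j) := by
    rw [Finset.mul_sum, Finset.mul_sum]
    exact Finset.sum_le_sum fun j _ => h _ _ _ _ (by ring) (by omega) (by omega)
  have h₂ : (∑ j ∈ range (c + 1), N (q - j)) * N (p - c) ≤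
      N (q - c) * ∑ j ∈ range (c + 1), N (p - j) := by
    rw [Finset.mul_sum, Finset.sum_mul]
    refine Finset.sum_le_sum fun j hj => ?_
    have := Finset.mem_range.1 hj
    exact h _ _ _ _ (by ring) (by omega) (by omega)
  simp only [shift]
  linarith

theorem isLogConcaveSeq_card_boxLevel {d : ℕ} (k : Fin d → ℕ) :
    IsLogConcaveSeq (fun m => (#(boxLevel k m) : ℝ)) := by
  induction d with
  | zero =>
    have hcard (m : ℤ) : (#(boxLevel k m) : ℝ) = if m = 0 then 1 else 0 := by
      have : boxLevel k m = if m = 0 then {k} else ∅ := by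
        ext a
        split_ifs with hm <;> simp [mem_boxLevel, Subsingleton.elim a k, hm, eq_comm]
      rw [this]
      split_ifs <;> simp
    intro x y u v hxy hx hy
    simp only [hcard]
    split_ifs <;> first | omega | norm_num
  | succ d ih =>
    simp only [card_boxLevel_succ]
    exact (ih (Fin.tail k)).sum_window (k 0)

/-- Weighted averages over two adjacent windows of a log-concave sequence: if `φ j` is dominated by
both `γ j` and `γ (j + 1)`, then the average of `φ` is at most the average of `γ`. -/
theorem IsLogConcaveSeq.window_average_le {N : ℤ → ℝ} (h : IsLogConcaveSeq N) (hN : ∀ i, 0 ≤ N i)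
    (m : ℤ) (c : ℕ) (φ γ : ℕ → ℝ)
    (hsucc : ∀ j < c, N (m - j) ≠ 0 → φ j ≤ γ (j + 1))
    (hself : ∀ j ≤ c, N (m - j) ≠ 0 → N (m + 1 - j) ≠ 0 → φ j ≤ γ j) :
    (∑ j ∈ range (c + 1), N (m - j) * φ j) * ∑ j ∈ range (c + 1), N (m + 1 - j) ≤
      (∑ j ∈ range (c + 1), N (m + 1 - j) * γ j) * ∑ j ∈ range (c + 1), N (m - j) := by
  set a : ℕ → ℝ := fun j => ∑ i ∈ range j, N (m - i) with ha
  set b : ℕ → ℝ := fun j => ∑ i ∈ range j, N (m + 1 - i) with hb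
  have ha_succ (j : ℕ) : a (j + 1) = a j + N (m - j) := Finset.sum_range_succ _ _
  have hb_succ (j : ℕ) : b (j + 1) = b j + N (m + 1 - j) := Finset.sum_range_succ _ _
  have hb_succ' (j : ℕ) : b (j + 1) = N (m + 1) + a j := sum_window_add_one N m j
  have ha_nonneg (j : ℕ) : 0 ≤ a j := Finset.sum_nonneg fun _ _ => hN _
  -- `X j` is the mass moved from `j - 1` to `j`, and `Y j` is the mass that stays at `j`.
  set X : ℕ → ℝ := fun j => a j * b (c + 1) - b j * a (c + 1) with hX
  set Y : ℕ → ℝ := fun j => b (j + 1) * a (c + 1) - a j * b (c + 1) with hY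
  have hX_zero : X 0 = 0 := by simp [hX, ha, hb]
  have hX_last : X (c + 1) = 0 := by simp only [hX]; ring
  have hX_nonneg : ∀ j ≤ c + 1, 0 ≤ X j := by
    intro j hj
    have h₁ : a (c + 1) = a j + ∑ i ∈ Ico j (c + 1), N (m - i) :=
      (Finset.sum_range_add_sum_Ico _ hj).symm
    have h₂ : b (c + 1) = b j + ∑ i ∈ Ico j (c + 1), N (m + 1 - i) :=
      (Finset.sum_range_add_sum_Ico _ hj).symm
    have h₃ : b j * ∑ i ∈ Ico j (c + 1), N (m - i) ≤
        a j * ∑ i ∈ Ico j (c + 1), N (m + 1 - i) := by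
      simp only [ha, hb, Finset.sum_mul_sum]
      refine Finset.sum_le_sum fun i hi => Finset.sum_le_sum fun l hl => ?_
      have := Finset.mem_range.1 hi
      have := Finset.mem_Ico.1 hl
      exact h _ _ _ _ (by ring) (by omega) (by omega)
    simp only [hX, h₁, h₂]
    linarith
  have hY_nonneg : ∀ j ≤ c, 0 ≤ Y j := by
    intro j hj
    have h₁ : a j ≤ a (c + 1) :=
      Finset.sum_le_sum_of_subset_of_nonneg (Finset.range_mono (by omega)) fun _ _ _ => hN _
    have h₂ : b (c + 1) ≤ N (m + 1) + a (c + 1) := by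
      rw [hb_succ', ha_succ]
      linarith [hN (m - c)]
    have h₃ := mul_le_mul_of_nonneg_left h₂ (ha_nonneg j)
    have h₄ := mul_le_mul_of_nonneg_left h₁ (hN (m + 1))
    simp only [hY, hb_succ' j]
    linarith
  have hYX_source (j : ℕ) : Y j + X (j + 1) = N (m - j) * b (c + 1) := by
    simp only [hX, hY, ha_succ j]; ring
  have hYX_target (j : ℕ) : Y j + X j = N (m + 1 - j) * a (c + 1) := by
    simp only [hX, hY, hb_succ j]; ring
  have hY_le : ∀ j ≤ c, Y j * φ j ≤ Y j * γ j := by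
    intro j hj
    have hXj := hX_nonneg j (by omega)
    have hXj' := hX_nonneg (j + 1) (by omega)
    have hYj := hY_nonneg j hj
    by_cases h₁ : N (m - j) = 0
    · have := hYX_source j
      rw [h₁, zero_mul] at this
      rw [show Y j = 0 by linarith, zero_mul, zero_mul]
    by_cases h₂ : N (m + 1 - j) = 0
    · have := hYX_target j
      rw [h₂, zero_mul] at this
      rw [show Y j = 0 by linarith, zero_mul, zero_mul]
    exact mul_le_mul_of_nonneg_left (hself j hj h₁ h₂) hYj
  have hX_le : ∀ j ≤ c, X (j + 1) * φ j ≤ X (j + 1) * γ (j + 1) := by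
    intro j hj
    have hXj' := hX_nonneg (j + 1) (by omega)
    have hYj := hY_nonneg j hj
    by_cases h₁ : N (m - j) = 0
    · have := hYX_source j
      rw [h₁, zero_mul] at this
      rw [show X (j + 1) = 0 by linarith, zero_mul, zero_mul]
    rcases hj.lt_or_eq with hlt | rfl
    · exact mul_le_mul_of_nonneg_left (hsucc j hlt h₁) hXj'
    · rw [hX_last, zero_mul, zero_mul]
  have hshift : ∑ j ∈ range (c + 1), X (j + 1) * γ (j + 1) = ∑ j ∈ range (c + 1), X j * γ j := by
    have h₁ := Finset.sum_range_succ (fun j => X j * γ j) (c + 1)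
    rw [Finset.sum_range_succ', hX_zero, hX_last] at h₁
    linarith
  calc (∑ j ∈ range (c + 1), N (m - j) * φ j) * b (c + 1)
      = ∑ j ∈ range (c + 1), (Y j * φ j + X (j + 1) * φ j) := by
        rw [Finset.sum_mul]
        refine Finset.sum_congr rfl fun j _ => ?_
        rw [← add_mul, hYX_source]; ring
    _ ≤ ∑ j ∈ range (c + 1), (Y j * γ j + X (j + 1) * γ (j + 1)) := by
        refine Finset.sum_le_sum fun j hj => ?_
        have := Finset.mem_range_succ_iff.1 hj
        exact add_le_add (hY_le j this) (hX_le j this)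
    _ = ∑ j ∈ range (c + 1), (Y j * γ j + X j * γ j) := by
        rw [Finset.sum_add_distrib, hshift, ← Finset.sum_add_distrib]
    _ = (∑ j ∈ range (c + 1), N (m + 1 - j) * γ j) * a (c + 1) := by
        rw [Finset.sum_mul]
        refine Finset.sum_congr rfl fun j _ => ?_
        rw [← add_mul, hYX_target]; ring

/-- The functional form of the normalized matching property of a product of chains. -/
theorem sum_boxLevel_mul_card_le {d : ℕ} (k : Fin d → ℕ) (m : ℤ) (f g : (Fin d → ℕ) → ℝ)
    (hfg : ∀ a ∈ boxLevel k m, ∀ b ∈ boxLevel k (m + 1), a ≤ b → f a ≤ g b) :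
    (∑ a ∈ boxLevel k m, f a) * #(boxLevel k (m + 1)) ≤
      (∑ b ∈ boxLevel k (m + 1), g b) * #(boxLevel k m) := by
  induction d generalizing m with
  | zero =>
    have hempty (i : ℤ) (hi : i ≠ 0) : boxLevel k i = ∅ := by
      ext a
      simp [mem_boxLevel, hi.symm]
    by_cases hm : m = 0
    · simp [hempty (m + 1) (by omega)]
    · simp [hempty m hm]
  | succ d ih =>
    set N : ℤ → ℝ := fun i => (#(boxLevel (Fin.tail k) i) : ℝ) with hN
    have hN_nonneg (i : ℤ) : 0 ≤ N i := Nat.cast_nonneg _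
    have hmul_avg (i : ℤ) (u : (Fin d → ℕ) → ℝ) :
        N i * ((∑ b ∈ boxLevel (Fin.tail k) i, u b) / N i) =
          ∑ b ∈ boxLevel (Fin.tail k) i, u b := by
      by_cases hi : N i = 0
      · have : boxLevel (Fin.tail k) i = ∅ := by simpa [hN] using hi
        simp [this]
      · exact mul_div_cancel₀ _ hi
    have key := (isLogConcaveSeq_card_boxLevel (Fin.tail k)).window_average_le hN_nonneg m (k 0)
      (fun j => (∑ b ∈ boxLevel (Fin.tail k) (m - j), f (Fin.cons j b)) / N (m - j))
      (fun j => (∑ b ∈ boxLevel (Fin.tail k) (m + 1 - j), g (Fin.cons j b)) / N (m + 1 - j))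
      ?_ ?_
    · simp only [sum_boxLevel_succ k, card_boxLevel_succ k]
      simp only [hN] at hmul_avg
      simpa only [hN, hmul_avg] using key
    · intro j hj _
      simp only [Nat.cast_add, Nat.cast_one, add_sub_add_right_eq_sub]
      refine div_le_div_of_nonneg_right (Finset.sum_le_sum fun b hb => ?_) (hN_nonneg _)
      refine hfg _ (cons_mem_boxLevel.2 ⟨hj.le, hb⟩) _ (cons_mem_boxLevel.2 ⟨hj, ?_⟩) ?_
      · simpa using hb
      · exact Fin.cons_le_cons.2 ⟨Nat.le_succ j, le_rfl⟩
    · intro j hj h₁ h₂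
      have hpos₁ : 0 < N (m - j) := (hN_nonneg _).lt_of_ne' h₁
      have hpos₂ : 0 < N (m + 1 - j) := (hN_nonneg _).lt_of_ne' h₂
      have := ih (Fin.tail k) (m - j) (fun b => f (Fin.cons j b)) (fun b => g (Fin.cons j b)) ?_
      · rw [sub_add_eq_add_sub] at this
        exact (div_le_div_iff₀ hpos₁ hpos₂).2 this
      · intro a ha b hb hab
        rw [sub_add_eq_add_sub] at hb
        exact hfg _ (cons_mem_boxLevel.2 ⟨hj, ha⟩) _ (cons_mem_boxLevel.2 ⟨hj, hb⟩)
          (Fin.cons_le_cons.2 ⟨le_rfl, hab⟩)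

theorem boxLevel_natCast {d : ℕ} (k : Fin d → ℕ) (m : ℕ) :
    boxLevel k m = (Finset.Iic k).filter (fun a : Fin d → ℕ => (∑ i, a i) = m) := by
  ext a
  rw [mem_boxLevel, Finset.mem_filter, Finset.mem_Iic]
  norm_cast

/-- Up-set density increases along level sets of the box `{𝐚 ≼ 𝐤}`:
`|𝒱^𝐤_{m+1}| · |T| ≤ |𝒱^𝐤_m| · |T⁺|` for `T ⊆ 𝒱^𝐤_m`,
where `T⁺ = (↑T) ∩ 𝒱^𝐤_{m+1}`. -/
theorem stmt4 (d : ℕ) (k : Fin d → ℕ) (m : ℕ)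
    (T : Finset (Fin d → ℕ))
    (hT : T ⊆ (Finset.Iic k).filter (fun a : Fin d → ℕ => (∑ i, a i) = m)) :
    ((Finset.Iic k).filter (fun a : Fin d → ℕ => (∑ i, a i) = m + 1)).card * T.card
      ≤ ((Finset.Iic k).filter (fun a : Fin d → ℕ => (∑ i, a i) = m)).card
        * (((Finset.Iic k).filter (fun a : Fin d → ℕ => (∑ i, a i) = m + 1)).filter
            (fun c : Fin d → ℕ => ∃ t ∈ T, t ≤ c)).card := by
  have key := sum_boxLevel_mul_card_le k m (fun a => if a ∈ T then 1 else 0)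
    (fun c => if ∃ t ∈ T, t ≤ c then 1 else 0) ?_
  · rw [← Nat.cast_succ, boxLevel_natCast, boxLevel_natCast, Finset.sum_boole, Finset.sum_boole,
      Finset.filter_mem_eq_inter, Finset.inter_eq_right.2 hT] at key
    rw [mul_comm, mul_comm (Finset.card _) (Finset.card (Finset.filter _ (Finset.filter _ _)))]
    exact_mod_cast key
  · intro a _ b _ hab
    by_cases ha : a ∈ T
    · simp only [ha, if_true]
      rw [if_pos ⟨a, ha, hab⟩]
    · simp only [ha, if_false]
      split_ifs <;> norm_num
end

section
/- Let 1 ≤ t ≤ p < ∞, E > n, let R, δ > 0 with Rδ ≥ 1, let f : ℝⁿ → ℂ be a Schwartz function whose Fourier transform is supported in a ball of radius Cδ, and let B ⊂ ℝⁿ be a ball of radius R. Then |B|^{−1/p}‖f‖_{L^p(w_{B,E})} ≲ (Rδ)^{n/t − n/p} |B|^{−1/t}‖f‖_{L^t(w_{B,Et/p})}, with implicit constant depending only on n, E, t, p, C (and not on R, δ, B, f), where w_{B,E}(x) := (1 + |x − c_B|/R)^{−E} for B = B(c_B, R). -/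
open MeasureTheory
open scoped FourierTransform
open scoped ENNReal SchwartzMap RealInnerProductSpace
open Module

/-- Jensen's inequality for the measure with density `k`. -/
theorem lintegral_mul_rpow_le {α : Type*} [MeasurableSpace α] {μ : Measure α}
    {g k : α → ℝ≥0∞} (hg : Measurable g) (hk : Measurable k) {t : ℝ} (ht : 1 ≤ t) :
    (∫⁻ y, g y * k y ∂μ) ^ t ≤ (∫⁻ y, k y ∂μ) ^ (t - 1) * ∫⁻ y, g y ^ t * k y ∂μ := by
  have ht0 : 0 < t := by linarith
  have h := eLpNorm'_le_eLpNorm'_mul_rpow_measure_univ (μ := μ.withDensity k) (f := g)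
    one_pos ht hg.aestronglyMeasurable
  simp only [eLpNorm'_eq_lintegral_enorm, enorm_eq_self, ENNReal.rpow_one, div_one,
    withDensity_apply _ MeasurableSet.univ, Measure.restrict_univ] at h
  rw [lintegral_withDensity_eq_lintegral_mul _ hk hg,
    lintegral_withDensity_eq_lintegral_mul _ hk (hg.pow_const t)] at h
  simp only [Pi.mul_apply, mul_comm (k _)] at h
  refine (ENNReal.rpow_le_rpow h ht0.le).trans_eq ?_
  rw [ENNReal.mul_rpow_of_nonneg _ _ ht0.le, ← ENNReal.rpow_mul, ← ENNReal.rpow_mul, mul_comm,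
    one_div_mul_cancel ht0.ne', ENNReal.rpow_one]
  congr 2
  field_simp

theorem exists_schwartz_eq_one_on_ball {V : Type*} [NormedAddCommGroup V]
    [InnerProductSpace ℝ V] [FiniteDimensional ℝ V] {r : ℝ} (hr : 0 < r) :
    ∃ χ : 𝓢(V, ℂ), ∀ ξ ∈ Metric.ball (0 : V) r, χ ξ = 1 := by
  let b : ContDiffBump (0 : V) := ⟨r, 2 * r, hr, by linarith⟩
  have h1 : HasCompactSupport fun x => ((b x : ℝ) : ℂ) :=
    b.hasCompactSupport.comp_left (g := fun z : ℝ => (z : ℂ)) (by simp)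
  have h2 : ContDiff ℝ (⊤ : ℕ∞) fun x => ((b x : ℝ) : ℂ) :=
    Complex.ofRealCLM.contDiff.comp b.contDiff
  refine ⟨h1.toSchwartzMap h2, fun ξ hξ => ?_⟩
  have : b ξ = 1 := b.one_of_mem_closedBall (Metric.ball_subset_closedBall hξ)
  simp [this]

theorem SchwartzMap.exists_norm_le_one_add_norm_rpow {V : Type*} [NormedAddCommGroup V]
    [NormedSpace ℝ V] (φ : 𝓢(V, ℂ)) (s : ℝ) :
    ∃ D : ℝ, 0 < D ∧ ∀ x, ‖φ x‖ ≤ D * (1 + ‖x‖) ^ (-s) := by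
  obtain ⟨k, hk⟩ := exists_nat_ge s
  refine ⟨2 ^ k * (Finset.Iic (k, 0)).sup
    (fun m => SchwartzMap.seminorm ℂ m.1 m.2) φ + 1, by positivity, fun x => ?_⟩
  have h := SchwartzMap.one_add_le_sup_seminorm_apply (𝕜 := ℂ) (m := (k, 0)) le_rfl le_rfl φ x
  rw [norm_iteratedFDeriv_zero] at h
  have h1 : (1 + ‖x‖) ^ s ≤ (1 + ‖x‖) ^ k := by
    rw [← Real.rpow_natCast]
    exact Real.rpow_le_rpow_of_exponent_le (by linarith [norm_nonneg x]) hk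
  rw [Real.rpow_neg (by positivity), ← div_eq_mul_inv, le_div_iff₀ (by positivity)]
  nlinarith [norm_nonneg (φ x), mul_le_mul_of_nonneg_left h1 (norm_nonneg (φ x))]

/-- The weight `1 + dist · c / R` varies slowly at scale `δ⁻¹ ≤ R`. -/
theorem one_add_dist_div_le {X : Type*} [PseudoMetricSpace X] {R δ : ℝ} (hR : 0 < R)
    (hRδ : 1 ≤ R * δ) (c x y : X) :
    1 + dist y c / R ≤ (1 + dist x c / R) * (1 + δ * dist x y) := by
  have h1 : dist y c / R ≤ dist x y / R + dist x c / R := by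
    rw [← add_div]
    gcongr
    rw [dist_comm x y]
    exact dist_triangle _ _ _
  have h2 : dist x y / R ≤ δ * dist x y := by
    rw [div_le_iff₀ hR]
    nlinarith [dist_nonneg (x := x) (y := y)]
  have h3 : 0 ≤ dist x c / R * (δ * dist x y) :=
    mul_nonneg (by positivity) (le_trans (by positivity) h2)
  linarith

theorem rpow_young_bound {A D a G t p : ℝ} {n : ℕ} (hA : 0 ≤ A) (hD : 0 ≤ D) (ha : 0 < a)
    (hG : 0 ≤ G) (ht : 1 ≤ t) (htp : t ≤ p) :
    ((A ^ (t - 1) * (D * a ^ n * G)) ^ ((p - t) / t) * (A ^ (t - 1) * (A * G))) ^ (1 / p) =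
      (((A ^ (t - 1) * D) ^ ((p - t) / t) * (A ^ (t - 1) * A)) ^ (1 / p)) *
        a ^ ((n : ℝ) / t - (n : ℝ) / p) * G ^ (1 / t) := by
  have ht0 : 0 < t := by linarith
  have hp0 : 0 < p := by linarith
  have hpt : 0 ≤ (p - t) / t := div_nonneg (by linarith) ht0.le
  have e : (A ^ (t - 1) * (D * a ^ n * G)) ^ ((p - t) / t) * (A ^ (t - 1) * (A * G)) =
      ((A ^ (t - 1) * D) ^ ((p - t) / t) * (A ^ (t - 1) * A)) *
        (a ^ n) ^ ((p - t) / t) * G ^ (p / t) := by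
    rw [show p / t = (p - t) / t + 1 by field_simp; ring,
      Real.rpow_add_of_nonneg hG hpt zero_le_one, Real.rpow_one,
      show A ^ (t - 1) * (D * a ^ n * G) = A ^ (t - 1) * D * a ^ n * G by ring,
      Real.mul_rpow (by positivity) hG, Real.mul_rpow (by positivity) (by positivity)]
    ring
  rw [e, Real.mul_rpow (by positivity) (by positivity),
    Real.mul_rpow (by positivity) (by positivity), ← Real.rpow_mul hG,
    ← Real.rpow_mul (pow_nonneg ha.le n), ← Real.rpow_natCast, ← Real.rpow_mul ha.le,
    show p / t * (1 / p) = 1 / t by field_simp,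
    show (n : ℝ) * ((p - t) / t * (1 / p)) = n / t - n / p by field_simp]

section

variable {V : Type*} [NormedAddCommGroup V] [InnerProductSpace ℝ V] [FiniteDimensional ℝ V]
  [MeasurableSpace V] [BorelSpace V]

/-- A form of Young's convolution inequality, for a bounded integrable kernel `k`. -/
theorem lintegral_rpow_le_of_le_convolution {h g k : V → ℝ≥0∞} (hg : Measurable g)
    (hk : Measurable k) {M : ℝ≥0∞} (hM : ∀ x, k x ≤ M)
    (hh : ∀ x, h x ≤ ∫⁻ y, g y * k (x - y)) {t p : ℝ} (ht : 1 ≤ t) (htp : t ≤ p) :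
    ∫⁻ x, h x ^ p ≤
      ((∫⁻ y, k y) ^ (t - 1) * (M * ∫⁻ y, g y ^ t)) ^ ((p - t) / t) *
        ((∫⁻ y, k y) ^ (t - 1) * ((∫⁻ y, k y) * ∫⁻ y, g y ^ t)) := by
  have ht0 : 0 < t := by linarith
  have hpt : 0 ≤ (p - t) / t := div_nonneg (by linarith) ht0.le
  have key : ∀ x, h x ^ t ≤ (∫⁻ y, k y) ^ (t - 1) * ∫⁻ y, g y ^ t * k (x - y) := by
    intro x
    refine (ENNReal.rpow_le_rpow (hh x) ht0.le).trans ?_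
    refine (lintegral_mul_rpow_le hg (k := fun y => k (x - y)) (by fun_prop) ht).trans_eq ?_
    rw [lintegral_sub_left_eq_self]
  have key1 : ∀ x, h x ^ t ≤ (∫⁻ y, k y) ^ (t - 1) * (M * ∫⁻ y, g y ^ t) := by
    intro x
    refine (key x).trans ?_
    rw [← lintegral_const_mul _ (hg.pow_const t)]
    refine mul_le_mul_right (lintegral_mono fun y => ?_) _
    rw [mul_comm]
    exact mul_le_mul_left (hM _) _
  calc ∫⁻ x, h x ^ p = ∫⁻ x, (h x ^ t) ^ ((p - t) / t) * h x ^ t := by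
        refine lintegral_congr fun x => ?_
        rw [← ENNReal.rpow_mul, mul_div_cancel₀ _ ht0.ne',
          ← ENNReal.rpow_add_of_nonneg _ _ (by linarith) ht0.le, sub_add_cancel]
    _ ≤ ∫⁻ x, ((∫⁻ y, k y) ^ (t - 1) * (M * ∫⁻ y, g y ^ t)) ^ ((p - t) / t) *
          ((∫⁻ y, k y) ^ (t - 1) * ∫⁻ y, g y ^ t * k (x - y)) := by
        gcongr with x
        · exact key1 x
        · exact key x
    _ = _ := by
        have hm : Measurable (Function.uncurry fun x y : V => g y ^ t * k (x - y)) :=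
          ((hg.comp measurable_snd).pow_const t).mul
            (hk.comp (measurable_fst.sub measurable_snd))
        have hm' : Measurable fun x : V => ∫⁻ y, g y ^ t * k (x - y) := hm.lintegral_prod_right'
        rw [lintegral_const_mul _ (hm'.const_mul _), lintegral_const_mul _ hm',
          lintegral_lintegral_swap hm.aemeasurable]
        congr 2
        rw [mul_comm, ← lintegral_mul_const _ (hg.pow_const t)]
        refine lintegral_congr fun y => ?_
        rw [lintegral_const_mul _ (by fun_prop), lintegral_sub_right_eq_self]

theorem fourier_modulate_dilate (χ : V → ℂ) {δ : ℝ} (hδ : 0 < δ) (ξ₀ x y : V) :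
    𝓕 (fun ξ => 𝐞 ⟪ξ, x⟫ • χ (δ⁻¹ • (ξ - ξ₀))) y =
      𝐞 ⟪ξ₀, x - y⟫ • ((δ ^ finrank ℝ V) • 𝓕⁻ χ (δ • (x - y))) := by
  rw [Real.fourier_eq, Real.fourierInv_eq,
    ← Measure.integral_comp_inv_smul_of_nonneg volume _ hδ.le, Circle.smul_def, ← integral_smul]
  refine Eq.trans ?_ (integral_sub_right_eq_self _ ξ₀)
  congr with ξ
  simp only [Circle.smul_def, smul_smul, ← Circle.coe_mul, ← AddChar.map_add_eq_mul]
  congr 3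
  simp only [inner_sub_left, inner_sub_right, inner_smul_left, inner_smul_right, conj_trivial]
  field_simp
  ring

/-- Reproducing formula: a Schwartz function whose Fourier transform lives in a ball of radius
`r * δ` is dominated by its convolution with the `δ⁻¹`-dilate of `𝓕⁻ χ`. -/
theorem enorm_le_lintegral_of_support_fourier (χ f : 𝓢(V, ℂ)) {r δ : ℝ} (hδ : 0 < δ)
    (hχ : ∀ ξ ∈ Metric.ball (0 : V) r, χ ξ = 1) {ξ₀ : V}
    (hf : Function.support (𝓕 ⇑f) ⊆ Metric.ball ξ₀ (r * δ)) (x : V) :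
    ‖f x‖ₑ ≤ ∫⁻ y, ‖f y‖ₑ * ‖(δ ^ finrank ℝ V) • (𝓕⁻ ⇑χ) (δ • (x - y))‖ₑ := by
  set φ : V → ℂ := fun ξ => 𝐞 ⟪ξ, x⟫ • χ (δ⁻¹ • (ξ - ξ₀))
  have hφ : Integrable φ := by
    have h1 : Integrable (fun ξ => χ (δ⁻¹ • (ξ - ξ₀))) :=
      ((χ.integrable (μ := volume)).comp_smul (inv_ne_zero hδ.ne')).comp_sub_right ξ₀
    refine h1.mono ?_ (.of_forall fun ξ => by simp [φ])
    refine Continuous.aestronglyMeasurable ?_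
    have := χ.continuous
    have := Real.continuous_fourierChar
    fun_prop
  have hfx : f x = ∫ y, f y • 𝓕 φ y := by
    have h0 : 𝓕⁻ (𝓕 ⇑f) x = f x := by
      rw [f.continuous.fourierInv_fourier_eq f.integrable]
      rw [← SchwartzMap.fourier_coe]
      exact (𝓕 f).integrable
    have h2 := VectorFourier.integral_fourierIntegral_smul_eq_flip (L := innerₗ V)
      Real.continuous_fourierChar continuous_inner (f.integrable (μ := volume)) hφ
    rw [flip_innerₗ] at h2
    refine Eq.trans ?_ h2
    rw [← h0, Real.fourierInv_eq]
    refine integral_congr_ae (.of_forall fun ξ => ?_)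
    change 𝐞 ⟪ξ, x⟫ • 𝓕 (⇑f) ξ = 𝓕 (⇑f) ξ • φ ξ
    by_cases hξ : 𝓕 (⇑f) ξ = 0
    · simp [hξ]
    · have hb : χ (δ⁻¹ • (ξ - ξ₀)) = 1 := by
        apply hχ
        have := hf hξ
        rw [mem_ball_iff_norm] at this
        rw [mem_ball_zero_iff, norm_smul, norm_inv, Real.norm_of_nonneg hδ.le,
          inv_mul_lt_iff₀ hδ]
        linarith
      simp only [φ, hb]
      rw [Circle.smul_def, Circle.smul_def]
      simp [mul_comm]
  calc ‖f x‖ₑ = ‖∫ y, f y • 𝓕 φ y‖ₑ := by rw [← hfx]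
    _ ≤ ∫⁻ y, ‖f y • 𝓕 φ y‖ₑ := enorm_integral_le_lintegral_enorm _
    _ = _ := by
        refine lintegral_congr fun y => ?_
        rw [enorm_smul, fourier_modulate_dilate χ hδ]
        congr 1
        simp only [enorm_eq_iff_norm_eq, Circle.norm_smul]

theorem lintegral_comp_smul_of_pos {g : V → ℝ≥0∞} (hg : Measurable g) {δ : ℝ} (hδ : 0 < δ) :
    ∫⁻ x, g (δ • x) = ENNReal.ofReal ((δ ^ finrank ℝ V)⁻¹) * ∫⁻ x, g x := by
  rw [← lintegral_map hg (measurable_const_smul δ), Measure.map_addHaar_smul volume hδ.ne',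
    lintegral_smul_measure, abs_of_pos (by positivity), smul_eq_mul]

/-- The weighted `L^t` to `L^p` bound before taking roots. -/
theorem exists_integral_weight_le {t p E r : ℝ} (ht : 1 ≤ t) (htp : t ≤ p) (hE : 0 ≤ E)
    (hr : 0 < r) :
    ∃ A D : ℝ, 0 ≤ A ∧ 0 ≤ D ∧ ∀ R δ : ℝ, 0 < R → 0 < δ → 1 ≤ R * δ →
      ∀ (f : 𝓢(V, ℂ)) (ξ₀ : V), Function.support (𝓕 ⇑f) ⊆ Metric.ball ξ₀ (r * δ) →
      ∀ c : V,
        ∫ x, ‖f x‖ ^ p * (1 + dist x c / R) ^ (-E) ≤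
          (A ^ (t - 1) * (D * δ ^ finrank ℝ V *
            ∫ x, ‖f x‖ ^ t * (1 + dist x c / R) ^ (-(E * t / p)))) ^ ((p - t) / t) *
          (A ^ (t - 1) * (A * ∫ x, ‖f x‖ ^ t * (1 + dist x c / R) ^ (-(E * t / p)))) := by
  have ht0 : 0 < t := by linarith
  have hp0 : 0 < p := by linarith
  obtain ⟨χ, hχ⟩ := exists_schwartz_eq_one_on_ball (V := V) hr
  obtain ⟨D, hD, hθ⟩ := SchwartzMap.exists_norm_le_one_add_norm_rpow (𝓕⁻ χ)
    (E / p + (finrank ℝ V + 1))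
  rw [SchwartzMap.fourierInv_coe] at hθ
  set J : ℝ≥0∞ := ∫⁻ x : V, ENNReal.ofReal ((1 + ‖x‖) ^ (-(finrank ℝ V + 1 : ℝ)))
  have hJtop : J < ∞ := finite_integral_one_add_norm (by linarith)
  refine ⟨D * J.toReal, D, by positivity, hD.le, fun R δ hR hδ hRδ f ξ₀ hf c => ?_⟩
  set w : V → ℝ := fun x => 1 + dist x c / R
  have hw1 : ∀ x, 1 ≤ w x := fun x => le_add_of_nonneg_right (by positivity)
  have hw0 : ∀ x, 0 < w x := fun x => one_pos.trans_le (hw1 x)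
  have hwc : Continuous w := by fun_prop
  set g : V → ℝ≥0∞ := fun x => ENNReal.ofReal (‖f x‖ * w x ^ (-(E / p))) with hg
  set k : V → ℝ≥0∞ := fun z =>
    ENNReal.ofReal (D * δ ^ finrank ℝ V * (1 + ‖δ • z‖) ^ (-(finrank ℝ V + 1 : ℝ))) with hk
  have hwr : ∀ s : ℝ, Continuous fun x => w x ^ s := fun s =>
    hwc.rpow_const fun x => Or.inl (hw0 x).ne'
  have hfn : ∀ s : ℝ, 0 < s → Continuous fun x => ‖f x‖ ^ s := fun s hs =>
    f.continuous.norm.rpow_const fun x => Or.inr hs.le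
  have hgm : Measurable g :=
    (f.continuous.norm.mul (hwr _)).measurable.ennreal_ofReal
  have hkm : Measurable k := by
    refine Measurable.ennreal_ofReal ?_
    fun_prop
  have hkle : ∀ x, k x ≤ ENNReal.ofReal (D * δ ^ finrank ℝ V) := fun x => by
    refine ENNReal.ofReal_le_ofReal (mul_le_of_le_one_right (by positivity) ?_)
    exact Real.rpow_le_one_of_one_le_of_nonpos (by linarith [norm_nonneg (δ • x)])
      (by linarith [(Nat.cast_nonneg (finrank ℝ V) : (0 : ℝ) ≤ _)])
  have hkint : ∫⁻ x, k x = ENNReal.ofReal (D * J.toReal) := by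
    have hm : Measurable fun x : V =>
        ENNReal.ofReal ((1 + ‖x‖) ^ (-(finrank ℝ V + 1 : ℝ))) := by
      refine Measurable.ennreal_ofReal ?_
      fun_prop
    simp only [hk]
    simp_rw [ENNReal.ofReal_mul (show 0 ≤ D * δ ^ finrank ℝ V by positivity)]
    rw [lintegral_const_mul _ (by fun_prop),
      lintegral_comp_smul_of_pos hm hδ, ← mul_assoc, ← ENNReal.ofReal_mul (by positivity),
      mul_assoc D, mul_inv_cancel₀ (by positivity), mul_one, ENNReal.ofReal_mul hD.le,
      ENNReal.ofReal_toReal hJtop.ne]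
  have hconv : ∀ x, g x ≤ ∫⁻ y, g y * k (x - y) := fun x => by
    calc g x = ‖f x‖ₑ * ENNReal.ofReal (w x ^ (-(E / p))) := by
          simp only [hg]
          rw [ENNReal.ofReal_mul (norm_nonneg _), ofReal_norm]
      _ ≤ (∫⁻ y, ‖f y‖ₑ * ‖(δ ^ finrank ℝ V) • (𝓕⁻ ⇑χ) (δ • (x - y))‖ₑ) *
            ENNReal.ofReal (w x ^ (-(E / p))) := by
          gcongr
          exact enorm_le_lintegral_of_support_fourier χ f hδ hχ hf x
      _ = ∫⁻ y, ‖f y‖ₑ * ‖(δ ^ finrank ℝ V) • (𝓕⁻ ⇑χ) (δ • (x - y))‖ₑ *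
            ENNReal.ofReal (w x ^ (-(E / p))) := (lintegral_mul_const' _ _ (by simp)).symm
      _ ≤ _ := by
          refine lintegral_mono fun y => ?_
          simp only [hg, hk]
          rw [← ofReal_norm, ← ofReal_norm, ← ENNReal.ofReal_mul (by positivity),
            ← ENNReal.ofReal_mul (by positivity),
            ← ENNReal.ofReal_mul (mul_nonneg (norm_nonneg _) (Real.rpow_nonneg (hw0 y).le _))]
          refine ENNReal.ofReal_le_ofReal ?_
          have hz : 1 + ‖δ • (x - y)‖ = 1 + δ * dist x y := by
            rw [norm_smul, Real.norm_of_nonneg hδ.le, dist_eq_norm]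
          have hz0 : 0 < 1 + δ * dist x y := by positivity
          have h1 := hθ (δ • (x - y))
          rw [neg_add, Real.rpow_add (by positivity), hz] at h1
          have h2 : (1 + δ * dist x y) ^ (-(E / p)) * w x ^ (-(E / p)) ≤ w y ^ (-(E / p)) := by
            rw [← Real.mul_rpow hz0.le (hw0 x).le, mul_comm]
            exact Real.rpow_le_rpow_of_nonpos (hw0 y) (one_add_dist_div_le hR hRδ c x y)
              (by simp only [Left.neg_nonpos_iff]; positivity)
          rw [norm_smul, norm_pow, Real.norm_of_nonneg hδ.le, hz]
          have hwx := Real.rpow_nonneg (hw0 x).le (-(E / p))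
          calc ‖f y‖ * (δ ^ finrank ℝ V * ‖(𝓕⁻ ⇑χ) (δ • (x - y))‖) * w x ^ (-(E / p))
              ≤ ‖f y‖ * (δ ^ finrank ℝ V * (D * ((1 + δ * dist x y) ^ (-(E / p)) *
                (1 + δ * dist x y) ^ (-(finrank ℝ V + 1 : ℝ))))) * w x ^ (-(E / p)) := by
                gcongr
            _ = ‖f y‖ * ((1 + δ * dist x y) ^ (-(E / p)) * w x ^ (-(E / p))) *
                (D * δ ^ finrank ℝ V * (1 + δ * dist x y) ^ (-(finrank ℝ V + 1 : ℝ))) := by ring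
            _ ≤ _ := by gcongr
  have hpow : ∀ s x, 0 < s →
      g x ^ s = ENNReal.ofReal (‖f x‖ ^ s * w x ^ (-(E * s / p))) := fun s x hs => by
    have hwx := Real.rpow_nonneg (hw0 x).le (-(E / p))
    simp only [hg]
    rw [ENNReal.ofReal_rpow_of_nonneg (by positivity) hs.le,
      Real.mul_rpow (norm_nonneg _) hwx, ← Real.rpow_mul (hw0 x).le]
    congr 3
    ring
  have hnn : ∀ s x, 0 ≤ ‖f x‖ ^ s * w x ^ (-(E * s / p)) := fun s x =>
    mul_nonneg (by positivity) (Real.rpow_nonneg (hw0 x).le _)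
  have hcont : ∀ s, 0 < s → Continuous fun x => ‖f x‖ ^ s * w x ^ (-(E * s / p)) :=
    fun s hs => (hfn s hs).mul (hwr _)
  have hint : Integrable fun x => ‖f x‖ ^ t * w x ^ (-(E * t / p)) := by
    have hm := (f.memLp (ENNReal.ofReal t) volume).integrable_norm_rpow
      (by simpa using ht0) ENNReal.ofReal_ne_top
    rw [ENNReal.toReal_ofReal ht0.le] at hm
    refine hm.mono' (hcont t ht0).aestronglyMeasurable (.of_forall fun x => ?_)
    rw [Real.norm_of_nonneg (hnn t x)]
    exact mul_le_of_le_one_right (by positivity)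
      (Real.rpow_le_one_of_one_le_of_nonpos (hw1 x) (by
        simp only [Left.neg_nonpos_iff]; positivity))
  have hY := lintegral_rpow_le_of_le_convolution hgm hkm hkle hconv ht htp
  simp_rw [fun x => hpow t x ht0, fun x => hpow p x hp0] at hY
  rw [hkint, ← ofReal_integral_eq_lintegral_ofReal hint (.of_forall (hnn t))] at hY
  have hG : 0 ≤ ∫ x, ‖f x‖ ^ t * w x ^ (-(E * t / p)) := integral_nonneg (hnn t)
  have hpt : 0 ≤ (p - t) / t := div_nonneg (by linarith) ht0.le
  rw [ENNReal.ofReal_rpow_of_nonneg (by positivity) (by linarith),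
    ← ENNReal.ofReal_mul (by positivity), ← ENNReal.ofReal_mul (by positivity),
    ← ENNReal.ofReal_mul (by positivity), ← ENNReal.ofReal_mul (by positivity),
    ENNReal.ofReal_rpow_of_nonneg (by positivity) hpt,
    ← ENNReal.ofReal_mul (by positivity)] at hY
  have hLHS : ∫ x, ‖f x‖ ^ p * w x ^ (-E) = ∫ x, ‖f x‖ ^ p * w x ^ (-(E * p / p)) := by
    rw [mul_div_cancel_right₀ _ hp0.ne']
  rw [hLHS, integral_eq_lintegral_of_nonneg_ae (.of_forall (hnn p))
    (hcont p hp0).aestronglyMeasurable]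
  exact ENNReal.toReal_le_of_le_ofReal (by positivity) hY

end

/-- Reverse Hölder inequality: for `1 ≤ t ≤ p < ∞`, `E > n`, `Rδ ≥ 1`, and a
Schwartz function `f` on `ℝⁿ` whose Fourier transform is supported in a ball
of radius `Cb·δ`, and any ball `B = B(c,R)`,
`|B|^{-1/p} ‖f‖_{L^p(w_{B,E})} ≲ (Rδ)^{n/t−n/p} |B|^{-1/t} ‖f‖_{L^t(w_{B,Et/p})}`
with constant independent of `R`, `δ`, `B`, `f`. -/
theorem stmt18 (n : ℕ) (hn : 1 ≤ n) (t p E Cb : ℝ)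
    (ht : 1 ≤ t) (htp : t ≤ p) (hE : (n : ℝ) < E) (hCb : 0 < Cb) :
    ∃ C : ℝ, 0 < C ∧
      ∀ (R δ : ℝ), 0 < R → 0 < δ → 1 ≤ R * δ →
      ∀ (f : SchwartzMap (EuclideanSpace ℝ (Fin n)) ℂ)
        (ξ₀ : EuclideanSpace ℝ (Fin n)),
        Function.support (𝓕 ⇑f) ⊆ Metric.ball ξ₀ (Cb * δ) →
      ∀ c : EuclideanSpace ℝ (Fin n),
        ((volume (Metric.ball c R)).toReal) ^ (-(1 : ℝ) / p)
            * (∫ x, ‖f x‖ ^ p * (1 + dist x c / R) ^ (-E)) ^ (1 / p)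
          ≤ C * (R * δ) ^ ((n : ℝ) / t - (n : ℝ) / p)
            * ((volume (Metric.ball c R)).toReal) ^ (-(1 : ℝ) / t)
            * (∫ x, ‖f x‖ ^ t * (1 + dist x c / R) ^ (-(E * t / p))) ^ (1 / t) := by
  have ht0 : 0 < t := by linarith
  have hp0 : 0 < p := by linarith
  have hn0 : (0 : ℝ) ≤ n := n.cast_nonneg
  obtain ⟨A, D, hA, hD, hAD⟩ := exists_integral_weight_le (V := EuclideanSpace ℝ (Fin n))
    ht htp (hn0.trans hE.le) hCb
  rw [finrank_euclideanSpace_fin] at hAD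
  set v : ℝ := (volume (Metric.ball (0 : EuclideanSpace ℝ (Fin n)) 1)).toReal
  have hv0 : 0 < v := ENNReal.toReal_pos (Metric.measure_ball_pos _ _ one_pos).ne'
    measure_ball_lt_top.ne
  set K : ℝ := ((A ^ (t - 1) * D) ^ ((p - t) / t) * (A ^ (t - 1) * A)) ^ (1 / p) with hK
  have hK0 : 0 ≤ K := by positivity
  refine ⟨v ^ (1 / t - 1 / p) * K + 1, by positivity, fun R δ hR hδ hRδ f ξ₀ hf c => ?_⟩
  have hI := hAD R δ hR hδ hRδ f ξ₀ hf c
  set I := ∫ x, ‖f x‖ ^ p * (1 + dist x c / R) ^ (-E)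
  set G := ∫ x, ‖f x‖ ^ t * (1 + dist x c / R) ^ (-(E * t / p))
  have hI0 : 0 ≤ I := integral_nonneg fun x => by positivity
  have hG0 : 0 ≤ G := integral_nonneg fun x => by positivity
  have hvol : (volume (Metric.ball c R)).toReal = R ^ n * v := by
    rw [Measure.addHaar_ball_of_pos volume c hR, finrank_euclideanSpace_fin, ENNReal.toReal_mul,
      ENNReal.toReal_ofReal (by positivity)]
  have hV0 : 0 < R ^ n * v := by positivity
  have hVp : (R ^ n * v) ^ (-(1 : ℝ) / p) =
      R ^ ((n : ℝ) / t - (n : ℝ) / p) * v ^ (1 / t - 1 / p) * (R ^ n * v) ^ (-(1 : ℝ) / t) := by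
    rw [show -(1 : ℝ) / p = (1 / t - 1 / p) + -(1 : ℝ) / t by ring, Real.rpow_add hV0,
      Real.mul_rpow (by positivity) hv0.le, ← Real.rpow_natCast, ← Real.rpow_mul hR.le,
      show (n : ℝ) * (1 / t - 1 / p) = n / t - n / p by ring]
  rw [hvol]
  calc (R ^ n * v) ^ (-(1 : ℝ) / p) * I ^ (1 / p)
      ≤ (R ^ n * v) ^ (-(1 : ℝ) / p) * (K * δ ^ ((n : ℝ) / t - (n : ℝ) / p) * G ^ (1 / t)) := by
        rw [hK, ← rpow_young_bound hA hD hδ hG0 ht htp]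
        gcongr
    _ = (v ^ (1 / t - 1 / p) * K) * (R * δ) ^ ((n : ℝ) / t - (n : ℝ) / p) *
          (R ^ n * v) ^ (-(1 : ℝ) / t) * G ^ (1 / t) := by
        rw [hVp, Real.mul_rpow hR.le hδ.le]
        ring
    _ ≤ _ := by
        gcongr
        linarith
end
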